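/- Let X and Z be real Hilbert spaces, Y a real inner product space, T, T_n : X → Y (n = 1, 2, …) bounded linear operators, L : D(L) ⊆ X → Z a closed linear operator with closed range, and assume there exists k > 0 with ‖Tx‖² + ‖Lx‖² ≥ k‖x‖² for all x ∈ D(L). Let q > 1, y, y_n ∈ Y, α > 0, α_n ≥ 0, and define on D(L) the functionals J(x) = ‖Tx − y‖² + α‖Lx‖^q and J_n(x) = ‖T_n x − y_n‖² + α_n‖Lx‖^q. Assume that α_n → α, y_n → y, T_n x → T x uniformly on L-bounded subsets of D(L), and moreover that every T-L-bounded subset of D(L) is relatively compact in X. Let x̄ be the unique global minimizer of J and, for each n, let x_n be a global minimizer of J_n. Then x_n converges to x̄ in norm. -/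

import Mathlib

open Filter Topology

/-- Nonnegative functions whose `q`-th powers converge to `b ^ q` converge to `b`. -/
theorem tendsto_of_tendsto_rpow {ι : Type*} {l : Filter ι} {f : ι → ℝ} {b q : ℝ}
    (hf : ∀ i, 0 ≤ f i) (hb : 0 ≤ b) (hq : 0 < q)
    (h : Tendsto (fun i => f i ^ q) l (𝓝 (b ^ q))) : Tendsto f l (𝓝 b) := by
  have h1 := h.rpow_const (p := q⁻¹) (Or.inr (by positivity))
  rw [Real.rpow_rpow_inv hb hq.ne'] at h1
  exact h1.congr fun i => Real.rpow_rpow_inv (hf i) hq.ne'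

/-- The parallelogram identity in midpoint form. -/
theorem norm_sq_midpoint_eq {E : Type*} [NormedAddCommGroup E] [InnerProductSpace ℝ E]
    (u v : E) :
    ‖(1 / 2 : ℝ) • (u + v)‖ ^ 2 = (‖u‖ ^ 2 + ‖v‖ ^ 2) / 2 - ‖u - v‖ ^ 2 / 4 := by
  have h := parallelogram_law_with_norm ℝ u v
  rw [norm_smul, Real.norm_of_nonneg (by norm_num)]
  linarith

/-- The function `‖·‖ ^ q` is midpoint convex for `1 ≤ q`. -/
theorem norm_midpoint_rpow_le {E : Type*} [NormedAddCommGroup E] [NormedSpace ℝ E]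
    (u v : E) {q : ℝ} (hq : 1 ≤ q) :
    ‖(1 / 2 : ℝ) • (u + v)‖ ^ q ≤ (‖u‖ ^ q + ‖v‖ ^ q) / 2 := by
  have h1 : ‖(1 / 2 : ℝ) • (u + v)‖ ≤ 1 / 2 * ‖u‖ + 1 / 2 * ‖v‖ := by
    rw [norm_smul, Real.norm_of_nonneg (by norm_num)]
    linarith [norm_add_le u v]
  have h2 := (convexOn_rpow hq).2 (norm_nonneg u) (norm_nonneg v)
    (by norm_num : (0 : ℝ) ≤ 1 / 2) (by norm_num : (0 : ℝ) ≤ 1 / 2) (by norm_num)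
  simp only [smul_eq_mul] at h2
  calc _ ≤ (1 / 2 * ‖u‖ + 1 / 2 * ‖v‖) ^ q :=
        Real.rpow_le_rpow (norm_nonneg _) h1 (by linarith)
    _ ≤ _ := by linarith

/-- Minimizing sequences of a functional `‖T x - y‖ ^ 2 + α * ‖L x‖ ^ q` converge to its
minimizer in the seminorms `‖T x‖` and `‖L x‖`. -/
theorem tendsto_norm_map_sub_of_minimizing {D Y Z ι : Type*} {l : Filter ι}
    [AddCommGroup D] [Module ℝ D]
    [NormedAddCommGroup Y] [InnerProductSpace ℝ Y]
    [NormedAddCommGroup Z] [InnerProductSpace ℝ Z]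
    (T : D →ₗ[ℝ] Y) (L : D →ₗ[ℝ] Z) (y : Y) {α q : ℝ} (hα : 0 < α) (hq : 1 ≤ q) {a : D}
    (hmin : ∀ x, ‖T a - y‖ ^ 2 + α * ‖L a‖ ^ q ≤ ‖T x - y‖ ^ 2 + α * ‖L x‖ ^ q)
    {u : ι → D}
    (hu : Tendsto (fun i => ‖T (u i) - y‖ ^ 2 + α * ‖L (u i)‖ ^ q) l
      (𝓝 (‖T a - y‖ ^ 2 + α * ‖L a‖ ^ q))) :
    Tendsto (fun i => ‖T (u i) - T a‖) l (𝓝 0) ∧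
      Tendsto (fun i => ‖L (u i) - L a‖) l (𝓝 0) := by
  set m := ‖T a - y‖ ^ 2 + α * ‖L a‖ ^ q with hm
  set w : ι → D := fun i => (1 / 2 : ℝ) • (u i + a) with hw
  have hTw : ∀ i, T (w i) - y = (1 / 2 : ℝ) • ((T (u i) - y) + (T a - y)) := fun i => by
    simp only [hw, map_smul, map_add]
    module
  have hLw : ∀ i, L (w i) = (1 / 2 : ℝ) • (L (u i) + L a) := fun i => by
    simp only [hw, map_smul, map_add]
  have hLw_le : ∀ i, ‖L (w i)‖ ^ q ≤ (‖L (u i)‖ ^ q + ‖L a‖ ^ q) / 2 := fun i => by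
    rw [hLw]
    exact norm_midpoint_rpow_le _ _ hq
  have hTw_sq : ∀ i, ‖T (w i) - y‖ ^ 2 =
      (‖T (u i) - y‖ ^ 2 + ‖T a - y‖ ^ 2) / 2 - ‖T (u i) - T a‖ ^ 2 / 4 := fun i => by
    rw [hTw, norm_sq_midpoint_eq, sub_sub_sub_cancel_right]
  have hT : Tendsto (fun i => ‖T (u i) - T a‖) l (𝓝 0) := by
    have hsq : Tendsto (fun i => ‖T (u i) - T a‖ ^ 2) l (𝓝 0) := by
      refine squeeze_zero (fun i => by positivity) (fun i => ?_)
        (g := fun i => 2 * ((‖T (u i) - y‖ ^ 2 + α * ‖L (u i)‖ ^ q) - m)) ?_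
      · have h1 := hmin (w i)
        have h2 := mul_le_mul_of_nonneg_left (hLw_le i) hα.le
        rw [hTw_sq] at h1
        linarith
      · simpa using (hu.sub_const m).const_mul 2
    simpa [Real.sqrt_sq] using hsq.sqrt
  have hTu : Tendsto (fun i => T (u i)) l (𝓝 (T a)) := tendsto_iff_norm_sub_tendsto_zero.2 hT
  have hTu_sq : Tendsto (fun i => ‖T (u i) - y‖ ^ 2) l (𝓝 (‖T a - y‖ ^ 2)) :=
    (hTu.sub_const y).norm.pow 2
  have hTw_lim : Tendsto (fun i => ‖T (w i) - y‖ ^ 2) l (𝓝 (‖T a - y‖ ^ 2)) := by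
    have h := ((hTu_sq.add_const (‖T a - y‖ ^ 2)).div_const 2).sub ((hT.pow 2).div_const 4)
    simp only [hTw_sq]
    convert h using 2
    ring
  have hLu_rpow : Tendsto (fun i => ‖L (u i)‖ ^ q) l (𝓝 (‖L a‖ ^ q)) := by
    have h := (hu.sub hTu_sq).div_const α
    rw [hm] at h
    simpa [hα.ne'] using h
  have hLw_rpow : Tendsto (fun i => ‖L (w i)‖ ^ q) l (𝓝 (‖L a‖ ^ q)) := by
    refine tendsto_of_tendsto_of_tendsto_of_le_of_le
      (g := fun i => (m - ‖T (w i) - y‖ ^ 2) / α)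
      (h := fun i => (‖L (u i)‖ ^ q + ‖L a‖ ^ q) / 2) ?_ ?_ (fun i => ?_) hLw_le
    · have h := (hTw_lim.const_sub m).div_const α
      rw [hm] at h
      simpa [hα.ne'] using h
    · simpa using (hLu_rpow.add_const (‖L a‖ ^ q)).div_const 2
    · have h := hmin (w i)
      show (m - ‖T (w i) - y‖ ^ 2) / α ≤ ‖L (w i)‖ ^ q
      rw [div_le_iff₀ hα]
      linarith
  have hq0 : 0 < q := by linarith
  have hLu := tendsto_of_tendsto_rpow (fun i => norm_nonneg _) (norm_nonneg _) hq0 hLu_rpow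
  have hLw_lim := tendsto_of_tendsto_rpow (fun i => norm_nonneg _) (norm_nonneg _) hq0 hLw_rpow
  refine ⟨hT, ?_⟩
  have hsq : Tendsto (fun i => ‖L (u i) - L a‖ ^ 2) l (𝓝 0) := by
    have h := (((hLu.pow 2).add_const (‖L a‖ ^ 2)).const_mul 2).sub ((hLw_lim.pow 2).const_mul 4)
    convert h using 2 with i
    · rw [hLw, norm_sq_midpoint_eq]
      ring
    · ring
  simpa [Real.sqrt_sq] using hsq.sqrt

/-- Strong stability for the closed-operator penalizer (Lemma 4.2): if in addition
`T`-`L`-bounded subsets of `D(L)` are relatively compact in `X`, minimizers of the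
perturbed functionals `Jₙ(x) = ‖Tₙx - yₙ‖² + αₙ ‖Lx‖^q` converge in norm to the unique
minimizer of `J(x) = ‖Tx - y‖² + α ‖Lx‖^q`. -/
theorem strong_stability_closed_operator_penalizer
    {X Z Y : Type*}
    [NormedAddCommGroup X] [InnerProductSpace ℝ X] [CompleteSpace X]
    [NormedAddCommGroup Z] [InnerProductSpace ℝ Z] [CompleteSpace Z]
    [NormedAddCommGroup Y] [InnerProductSpace ℝ Y]
    (T : X →L[ℝ] Y) (Tn : ℕ → X →L[ℝ] Y) (L : X →ₗ.[ℝ] Z)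
    (hLclosed : L.IsClosed)
    (hLrange : IsClosed (LinearMap.range L.toFun : Set Z))
    (k : ℝ) (hk : 0 < k)
    (hcompl : ∀ x : L.domain, k * ‖(x : X)‖ ^ 2 ≤ ‖T (x : X)‖ ^ 2 + ‖L x‖ ^ 2)
    (q : ℝ) (hq : 1 < q)
    (y : Y) (yn : ℕ → Y) (α : ℝ) (hα : 0 < α) (αn : ℕ → ℝ) (hαn : ∀ n, 0 ≤ αn n)
    (hαconv : Tendsto αn atTop (𝓝 α)) (hyconv : Tendsto yn atTop (𝓝 y))
    -- Tₙ x → T x uniformly on L-bounded subsets of D(L)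
    (hTconsist : ∀ c : ℝ, 0 < c → ∀ ε : ℝ, 0 < ε → ∃ N : ℕ, ∀ n ≥ N, ∀ x : L.domain,
      ‖L x‖ ≤ c → ‖Tn n (x : X) - T (x : X)‖ < ε)
    -- T-L-bounded subsets of D(L) are relatively compact in X
    (hcompact : ∀ c : ℝ, IsCompact (closure
      {u : X | ∃ hu : u ∈ L.domain, ‖T u‖ + ‖L ⟨u, hu⟩‖ ≤ c}))
    -- x̄ is the unique global minimizer of J on D(L)
    (xbar : L.domain)
    (hxbarmin : ∀ x : L.domain,
      ‖T (xbar : X) - y‖ ^ 2 + α * ‖L xbar‖ ^ q ≤ ‖T (x : X) - y‖ ^ 2 + α * ‖L x‖ ^ q)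
    (hxbaruniq : ∀ x' : L.domain,
      (∀ x : L.domain,
        ‖T (x' : X) - y‖ ^ 2 + α * ‖L x'‖ ^ q ≤ ‖T (x : X) - y‖ ^ 2 + α * ‖L x‖ ^ q) →
      x' = xbar)
    -- each xₙ is a global minimizer of Jₙ on D(L)
    (xn : ℕ → L.domain)
    (hxnmin : ∀ n, ∀ x : L.domain,
      ‖Tn n (xn n : X) - yn n‖ ^ 2 + αn n * ‖L (xn n)‖ ^ q ≤
        ‖Tn n (x : X) - yn n‖ ^ 2 + αn n * ‖L x‖ ^ q) :
    Tendsto (fun n => (xn n : X)) atTop (𝓝 (xbar : X)) := by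
  have hq0 : 0 < q := by linarith
  set m := ‖T (xbar : X) - y‖ ^ 2 + α * ‖L xbar‖ ^ q with hm
  have hTn_of_bdd : ∀ c : ℝ, 0 < c → ∀ u : ℕ → L.domain, (∀ᶠ n in atTop, ‖L (u n)‖ ≤ c) →
      Tendsto (fun n => Tn n (u n : X) - T (u n : X)) atTop (𝓝 0) := by
    intro c hc u hu
    rw [Metric.tendsto_nhds]
    intro ε hε
    obtain ⟨N, hN⟩ := hTconsist c hc ε hε
    filter_upwards [hu, eventually_ge_atTop N] with n h1 h2
    simpa using hN n h2 (u n) h1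
  have hTn_xbar : Tendsto (fun n => Tn n (xbar : X)) atTop (𝓝 (T (xbar : X))) := by
    have h := hTn_of_bdd (‖L xbar‖ + 1) (by positivity) (fun _ => xbar)
      (Eventually.of_forall fun _ => by linarith)
    exact tendsto_sub_nhds_zero_iff.1 h
  have hM : Tendsto (fun n => ‖Tn n (xbar : X) - yn n‖ ^ 2 + αn n * ‖L xbar‖ ^ q) atTop (𝓝 m) :=
    ((hTn_xbar.sub hyconv).norm.pow 2).add (hαconv.mul_const _)
  have hM_le : ∀ᶠ n in atTop, ‖Tn n (xn n : X) - yn n‖ ^ 2 + αn n * ‖L (xn n)‖ ^ q ≤ m + 1 := by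
    filter_upwards [hM.eventually_le_const (lt_add_one m)] with n hn
    exact (hxnmin n xbar).trans hn
  have hm0 : 0 ≤ m := by positivity
  have hL_rpow : ∀ᶠ n in atTop, ‖L (xn n)‖ ^ q ≤ (m + 1) / (α / 2) := by
    filter_upwards [hM_le, hαconv.eventually_const_le (half_lt_self hα)] with n h1 h2
    rw [le_div_iff₀ (by positivity)]
    have h3 : 0 ≤ ‖L (xn n)‖ ^ q := by positivity
    nlinarith [sq_nonneg ‖Tn n (xn n : X) - yn n‖]
  have hL_le : ∀ᶠ n in atTop, ‖L (xn n)‖ ≤ ((m + 1) / (α / 2)) ^ q⁻¹ := by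
    filter_upwards [hL_rpow] with n hn
    exact (Real.le_rpow_inv_iff_of_pos (norm_nonneg _) (by positivity) hq0).2 hn
  have hres : Tendsto (fun n => (T (xn n : X) - y) - (Tn n (xn n : X) - yn n)) atTop (𝓝 0) := by
    have h := (hyconv.sub_const y).sub (hTn_of_bdd _ (by positivity) xn hL_le)
    simp only [sub_self] at h
    exact h.congr fun n => by abel
  have hres_norm : Tendsto (fun n => ‖T (xn n : X) - y‖ - ‖Tn n (xn n : X) - yn n‖)
      atTop (𝓝 0) :=
    squeeze_zero_norm (fun n => abs_norm_sub_norm_le _ _) (tendsto_zero_iff_norm_tendsto_zero.1 hres)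
  have hres_sq : Tendsto (fun n => ‖T (xn n : X) - y‖ ^ 2 - ‖Tn n (xn n : X) - yn n‖ ^ 2)
      atTop (𝓝 0) := by
    have hb : IsBoundedUnder (· ≤ ·) atTop (norm ∘ fun n => ‖Tn n (xn n : X) - yn n‖) := by
      refine isBoundedUnder_of_eventually_le (a := m + 1) ?_
      filter_upwards [hM_le] with n hn
      have h1 : 0 ≤ αn n * ‖L (xn n)‖ ^ q := mul_nonneg (hαn n) (by positivity)
      simp only [Function.comp_apply, norm_norm]
      nlinarith [norm_nonneg (Tn n (xn n : X) - yn n)]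
    have h := (hres_norm.pow 2).add ((hres_norm.zero_mul_isBoundedUnder_le hb).const_mul 2)
    convert h using 2 <;> ring
  have hpen : Tendsto (fun n => (α - αn n) * ‖L (xn n)‖ ^ q) atTop (𝓝 0) := by
    have h0 : Tendsto (fun n => α - αn n) atTop (𝓝 0) := by simpa using hαconv.const_sub α
    refine h0.zero_mul_isBoundedUnder_le
      (isBoundedUnder_of_eventually_le (a := (m + 1) / (α / 2)) ?_)
    filter_upwards [hL_rpow] with n hn
    rwa [Function.comp_apply, Real.norm_of_nonneg (by positivity)]
  have hJ : Tendsto (fun n => ‖T (xn n : X) - y‖ ^ 2 + α * ‖L (xn n)‖ ^ q) atTop (𝓝 m) := by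
    have h := (hM.add hres_sq).add hpen
    simp only [add_zero] at h
    refine tendsto_of_tendsto_of_tendsto_of_le_of_le tendsto_const_nhds h
      (fun n => hxbarmin (xn n)) (fun n => ?_)
    have h1 := hxnmin n xbar
    dsimp only
    linarith
  obtain ⟨hT, hL⟩ := tendsto_norm_map_sub_of_minimizing (T.toLinearMap ∘ₗ L.domain.subtype)
    L.toFun y hα hq.le hxbarmin hJ
  have hsum : Tendsto (fun n => ‖(xn n : X) - xbar‖ ^ 2) atTop (𝓝 0) := by
    have h := ((hT.pow 2).add (hL.pow 2)).div_const k
    refine squeeze_zero (fun n => by positivity) (fun n => ?_) (by simpa using h)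
    rw [le_div_iff₀ hk]
    have h1 := hcompl (xn n - xbar)
    rw [LinearPMap.map_sub, Submodule.coe_sub, map_sub] at h1
    simpa [mul_comm] using h1
  rw [tendsto_iff_norm_sub_tendsto_zero]
  simpa [Real.sqrt_sq] using hsum.sqrt
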